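/- Let 1/2 ≤ δ < 1 be a fixed real constant and, for each n, set k = ⌈n^{1/3}⌉ and m = ⌊δn⌋ − k. Let G be drawn from 𝓗₂(n,m) and, independently, let α be drawn from 𝓕₁(n,2k). Then lim_{n→∞} Pr[α ∧ G is satisfiable] = 1. -/

import Mathlib

open Finset Filter

/-- A 2-clause over variables `x_0, …, x_{n-1}`: an (ordered) pair of literals on two
distinct variables, the first literal having the smaller variable index.  A literal is a
pair (variable, polarity).  There are `4 * (n choose 2)` such clauses. -/
abbrev Clause (n : ℕ) := {p : (Fin n × Bool) × (Fin n × Bool) // p.1.1 < p.2.1}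

/-- Value of a literal under a total assignment. -/
def litVal {n : ℕ} (σ : Fin n → Bool) (ℓ : Fin n × Bool) : Bool :=
  if ℓ.2 then σ ℓ.1 else !(σ ℓ.1)

/-- A total assignment satisfies a 2-clause. -/
def clauseSat {n : ℕ} (σ : Fin n → Bool) (C : Clause n) : Prop :=
  litVal σ C.val.1 = true ∨ litVal σ C.val.2 = true

/-- Probability of the event `P` under the uniform distribution on the finite type `Ω`. -/
noncomputable def pr (Ω : Type*) [Fintype Ω] (P : Ω → Prop) : ℝ :=
  (Nat.card {ω : Ω // P ω} : ℝ) / (Fintype.card Ω : ℝ)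

/-- A partial assignment to the variables `x_0, …, x_{n-1}`. -/
abbrev PAssign (n : ℕ) := Fin n → Option Bool

/-- The (two-element) set of variables of a 2-clause. -/
def vars {n : ℕ} (C : Clause n) : Finset (Fin n) := {C.val.1.1, C.val.2.1}

/-- The set of variables assigned by a partial assignment. -/
def support {n : ℕ} (α : PAssign n) : Finset (Fin n) := univ.filter (fun x => (α x).isSome)

/-- Value of a literal under a partial assignment. -/
def plitVal {n : ℕ} (α : PAssign n) (ℓ : Fin n × Bool) : Option Bool :=
  (α ℓ.1).map (fun b => if ℓ.2 then b else !b)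

/-- A partial assignment satisfies a 2-clause. -/
def pClauseSat {n : ℕ} (α : PAssign n) (C : Clause n) : Prop :=
  plitVal α C.val.1 = some true ∨ plitVal α C.val.2 = some true

/-- The set of variables of a 2-CNF (a multiset of clauses). -/
def mvars {n : ℕ} (F : Multiset (Clause n)) : Finset (Fin n) := F.toFinset.biUnion vars

/-- `α ∈ sat(H)`: `α` is an assignment to exactly the variables of `H` satisfying `H`. -/
def satAssign {n : ℕ} (H : Multiset (Clause n)) (α : PAssign n) : Prop :=
  support α = mvars H ∧ ∀ C ∈ H, pClauseSat α C

/-- `F ∧ α` is satisfiable: `α` extends to a total assignment satisfying `F`. -/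
def extendable {n : ℕ} (F : Multiset (Clause n)) (α : PAssign n) : Prop :=
  ∃ σ : Fin n → Bool, (∀ x b, α x = some b → σ x = b) ∧ ∀ C ∈ F, clauseSat σ C

/-- `θ(H,F)`: the fraction of `α ∈ sat(H)` such that `F ∧ α` is satisfiable
(`1` if `H` is unsatisfiable). -/
noncomputable def theta {n : ℕ} (H F : Multiset (Clause n)) : ℝ :=
  if Nat.card {α : PAssign n // satAssign H α} = 0 then 1
  else (Nat.card {α : PAssign n // satAssign H α ∧ extendable F α} : ℝ) /
    (Nat.card {α : PAssign n // satAssign H α} : ℝ)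

/-- Partial assignments assigning exactly `k` variables (`𝓕₁(n,k)` sample space). -/
abbrev PAk (n k : ℕ) := {α : PAssign n // (support α).card = k}

/-- The complementary literal. -/
def litNeg {n : ℕ} (a : Fin n × Bool) : Fin n × Bool := (a.1, !a.2)

@[simp] lemma litNeg_litNeg {n : ℕ} (a : Fin n × Bool) : litNeg (litNeg a) = a := by
  simp [litNeg]

@[simp] lemma litNeg_fst {n : ℕ} (a : Fin n × Bool) : (litNeg a).1 = a.1 := rfl

lemma litNeg_ne {n : ℕ} (a : Fin n × Bool) : litNeg a ≠ a := by
  obtain ⟨v, b⟩ := a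
  cases b <;> simp [litNeg]

lemma eq_or_eq_litNeg_of_fst_eq {n : ℕ} {a b : Fin n × Bool} (h : a.1 = b.1) :
    a = b ∨ a = litNeg b := by
  obtain ⟨v, s⟩ := a
  obtain ⟨w, t⟩ := b
  obtain rfl : v = w := h
  cases s <;> cases t <;> simp [litNeg]

/-- The implication digraph of a set of unordered pairs of literals (a pair with two equal
entries is a unit clause). -/
def Implies {n : ℕ} (S : Set (Sym2 (Fin n × Bool))) (a b : Fin n × Bool) : Prop :=
  s(litNeg a, b) ∈ S

lemma Implies.contrapose {n : ℕ} {S : Set (Sym2 (Fin n × Bool))} {a b : Fin n × Bool}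
    (h : Implies S a b) : Implies S (litNeg b) (litNeg a) := by
  unfold Implies at *
  rwa [litNeg_litNeg, Sym2.eq_swap]

lemma reach_contrapose {n : ℕ} {S : Set (Sym2 (Fin n × Bool))} {a b : Fin n × Bool}
    (h : Relation.ReflTransGen (Implies S) a b) :
    Relation.ReflTransGen (Implies S) (litNeg b) (litNeg a) := by
  induction h with
  | refl => exact .refl
  | tail _ hbc ih => exact .head hbc.contrapose ih

/-- A maximal consistent set of literals closed under implication is total, provided no literal
and its complement imply each other. -/
lemma exists_total_consistent {n : ℕ} (S : Set (Sym2 (Fin n × Bool)))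
    (hS : ∀ x, Relation.ReflTransGen (Implies S) x (litNeg x) →
      ¬ Relation.ReflTransGen (Implies S) (litNeg x) x) :
    ∃ T : Set (Fin n × Bool), (∀ a ∈ T, ∀ b, Implies S a b → b ∈ T) ∧
      (∀ a ∈ T, litNeg a ∉ T) ∧ ∀ a, a ∈ T ∨ litNeg a ∈ T := by
  let P : Set (Set (Fin n × Bool)) :=
    {T | (∀ a ∈ T, ∀ b, Implies S a b → b ∈ T) ∧ ∀ a ∈ T, litNeg a ∉ T}
  obtain ⟨T, ⟨hc, hn⟩, hmax⟩ := (Set.toFinite P).exists_maximal ⟨∅, by simp [P]⟩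
  refine ⟨T, hc, hn, ?_⟩
  have closed : ∀ a b, Relation.ReflTransGen (Implies S) a b → a ∈ T → b ∈ T := by
    intro a b h ha
    induction h with
    | refl => exact ha
    | tail _ hbc ih => exact hc _ ih _ hbc
  have key : ∀ x, litNeg x ∉ T → ¬ Relation.ReflTransGen (Implies S) x (litNeg x) → x ∈ T := by
    intro x hx2 hx
    have hU : T ∪ {b | Relation.ReflTransGen (Implies S) x b} ∈ P := by
      refine ⟨?_, ?_⟩
      · rintro a (ha | ha) b hab
        · exact Or.inl (hc a ha b hab)
        · exact Or.inr (Relation.ReflTransGen.tail ha hab)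
      · rintro a (ha | ha) (hb | hb)
        · exact hn a ha hb
        · have := reach_contrapose hb
          rw [litNeg_litNeg] at this
          exact hx2 (closed _ _ this ha)
        · exact hx2 (closed _ _ (reach_contrapose ha) hb)
        · have := reach_contrapose hb
          rw [litNeg_litNeg] at this
          exact hx (Relation.ReflTransGen.trans ha this)
    exact hmax hU Set.subset_union_left (Or.inr .refl)
  intro a
  by_contra! h
  by_cases h1 : Relation.ReflTransGen (Implies S) a (litNeg a)
  · refine h.2 (key (litNeg a) ?_ ?_)
    · simpa using h.1
    · simpa using hS a h1
  · exact h.1 (key a h.2 h1)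

/-- The 2-SAT criterion: an unsatisfiable formula has a literal that implies, and is implied by,
its complement. -/
lemma exists_contradictory_literal {n : ℕ} (S : Set (Sym2 (Fin n × Bool)))
    (hS : ¬ ∃ σ : Fin n → Bool, ∀ c ∈ S, ∃ l ∈ c, σ l.1 = l.2) :
    ∃ x, Relation.ReflTransGen (Implies S) x (litNeg x) ∧
      Relation.ReflTransGen (Implies S) (litNeg x) x := by
  classical
  by_contra! h
  obtain ⟨T, hc, hn, ht⟩ := exists_total_consistent S h
  have hσ : ∀ l ∈ T, decide ((l.1, true) ∈ T) = l.2 := by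
    rintro ⟨v, b⟩ hl
    cases b
    · simpa [litNeg] using hn _ hl
    · simpa using hl
  refine hS ⟨fun v => decide ((v, true) ∈ T), fun c hcS => ?_⟩
  induction c with
  | h a b =>
    rcases ht a with ha | ha
    · exact ⟨a, by simp, hσ a ha⟩
    · refine ⟨b, by simp, hσ b (hc _ ha b ?_)⟩
      simpa [Implies] using hcS

lemma exists_walk_of_reflTransGen {V : Type*} {E : V → V → Prop} {a b : V}
    (h : Relation.ReflTransGen E a b) :
    ∃ (p : ℕ) (f : ℕ → V), f 0 = a ∧ f p = b ∧ ∀ t < p, E (f t) (f (t + 1)) := by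
  induction h using Relation.ReflTransGen.head_induction_on with
  | refl => exact ⟨0, fun _ => b, rfl, rfl, by simp⟩
  | @head a c hac _ ih =>
    obtain ⟨p, f, h0, hp, hf⟩ := ih
    refine ⟨p + 1, fun t => t.casesOn a f, rfl, hp, ?_⟩
    rintro (_ | t) ht
    · simpa [h0] using hac
    · exact hf t (by omega)

lemma reflTransGen_of_walk {V : Type*} {E : V → V → Prop} {f : ℕ → V} {p : ℕ}
    (hf : ∀ t < p, E (f t) (f (t + 1))) {i j : ℕ} (hij : i ≤ j) (hj : j ≤ p) :
    Relation.ReflTransGen E (f i) (f j) := by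
  induction j, hij using Nat.le_induction with
  | base => exact .refl
  | succ j _ ih => exact (ih (by omega)).tail (hf j (by omega))

/-- A shortest implication walk from a literal on a contradictory cycle to its complement visits
distinct variables before its last step. -/
lemma exists_simple_contradictory_walk {n : ℕ} (S : Set (Sym2 (Fin n × Bool)))
    (hS : ∃ x, Relation.ReflTransGen (Implies S) x (litNeg x) ∧
      Relation.ReflTransGen (Implies S) (litNeg x) x) :
    ∃ (s : ℕ) (w : ℕ → Fin n × Bool), (∀ i j, i < j → j ≤ s → (w i).1 ≠ (w j).1) ∧
      (∀ t < s, Implies S (w t) (w (t + 1))) ∧ Implies S (w s) (litNeg (w 0)) ∧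
      Relation.TransGen (Implies S) (w 0) (w 0) := by
  classical
  have hex : ∃ p : ℕ, ∃ f : ℕ → Fin n × Bool, f p = litNeg (f 0) ∧
      (∀ t < p, Implies S (f t) (f (t + 1))) ∧
      Relation.ReflTransGen (Implies S) (litNeg (f 0)) (f 0) := by
    obtain ⟨x, hx, hx'⟩ := hS
    obtain ⟨p, f, h0, hp, hf⟩ := exists_walk_of_reflTransGen hx
    exact ⟨p, f, by rw [hp, h0], hf, by rwa [h0]⟩
  have hmin := fun q => Nat.find_min hex (m := q)
  obtain ⟨f, hp, hf, hback⟩ := Nat.find_spec hex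
  generalize Nat.find hex = p at *
  rcases p with _ | s
  · exact absurd hp.symm (litNeg_ne _)
  have hl : Implies S (f s) (litNeg (f 0)) := hp ▸ hf s (by omega)
  refine ⟨s, f, ?_, fun t ht => hf t (by omega), hl, ?_⟩
  · intro i j hij hj hv
    rcases eq_or_eq_litNeg_of_fst_eq hv with h | h
    · refine hmin (s + 1 - (j - i)) (by omega)
        ⟨fun t => if t ≤ i then f t else f (t + (j - i)), ?_, ?_, ?_⟩
      · have h1 : ¬ s + 1 - (j - i) ≤ i := by omega
        have h2 : s + 1 - (j - i) + (j - i) = s + 1 := by omega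
        simpa [h1, h2] using hp
      · intro t ht
        rcases lt_trichotomy t i with h1 | rfl | h1
        · have h2 : t ≤ i := by omega
          have h3 : t + 1 ≤ i := by omega
          simpa [h2, h3] using hf t (by omega)
        · have h2 : ¬ t + 1 ≤ t := by omega
          have h3 : t + 1 + (j - t) = j + 1 := by omega
          simpa [h2, h3, h] using hf j (by omega)
        · have h2 : ¬ t ≤ i := by omega
          have h3 : ¬ t + 1 ≤ i := by omega
          have h4 : t + 1 + (j - i) = t + (j - i) + 1 := by omega
          simpa [h2, h3, h4] using hf (t + (j - i)) (by omega)
      · simpa using hback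
    · refine hmin (j - i) (by omega) ⟨fun t => f (i + t), ?_, ?_, ?_⟩
      · have h1 : i + (j - i) = j := by omega
        simp [h1, h]
      · intro t ht
        exact hf (i + t) (by omega)
      · have h1 : Relation.ReflTransGen (Implies S) (f j) (litNeg (f 0)) :=
          hp ▸ reflTransGen_of_walk hf (show j ≤ s + 1 by omega) le_rfl
        have h2 := reflTransGen_of_walk hf (Nat.zero_le i) (show i ≤ s + 1 by omega)
        have h3 : litNeg (f i) = f j := by rw [h, litNeg_litNeg]
        simpa [h3] using (h1.trans hback).trans h2
  · have h1 := reflTransGen_of_walk hf (Nat.zero_le s) (show s ≤ s + 1 by omega)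
    exact (Relation.TransGen.tail' h1 hl).trans_left hback

/-- An unsatisfiable formula contains a chain of implications on distinct variables which bends
back at both ends. -/
lemma exists_bicycle {n : ℕ} (S : Set (Sym2 (Fin n × Bool)))
    (hS : ¬ ∃ σ : Fin n → Bool, ∀ c ∈ S, ∃ l ∈ c, σ l.1 = l.2) :
    ∃ (s : ℕ) (w : ℕ → Fin n × Bool), (∀ i j, i < j → j ≤ s → (w i).1 ≠ (w j).1) ∧
      (∀ t < s, Implies S (w t) (w (t + 1))) ∧
      (∃ j ≤ s, Implies S (w s) (litNeg (w j))) ∧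
      ∃ z, Implies S z (w 0) ∧ ∃ i ≤ s, z.1 = (w i).1 := by
  by_contra hno
  have grow : ∀ d : ℕ, ∃ (s : ℕ) (w : ℕ → Fin n × Bool), d ≤ s ∧
      (∀ i j, i < j → j ≤ s → (w i).1 ≠ (w j).1) ∧
      (∀ t < s, Implies S (w t) (w (t + 1))) ∧
      (∃ j ≤ s, Implies S (w s) (litNeg (w j))) ∧
      Relation.TransGen (Implies S) (w 0) (w 0) := by
    intro d
    induction d with
    | zero =>
      obtain ⟨s, w, h1, h2, h3, h4⟩ :=
        exists_simple_contradictory_walk S (exists_contradictory_literal S hS)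
      exact ⟨s, w, Nat.zero_le _, h1, h2, ⟨0, Nat.zero_le _, h3⟩, h4⟩
    | succ d ih =>
      obtain ⟨s, w, hd, h1, h2, ⟨j, hj, h3⟩, h4⟩ := ih
      obtain ⟨z, hz, hzw⟩ := Relation.TransGen.tail'_iff.mp h4
      refine ⟨s + 1, fun t => t.casesOn z w, by omega, ?_, ?_, ⟨j + 1, by omega, h3⟩,
        Relation.TransGen.head' hzw hz⟩
      · rintro (_ | i) (_ | j) hij hj
        · omega
        · intro h
          exact hno ⟨s, w, h1, h2, ⟨_, ‹_›, h3⟩, z, hzw, j, by omega, h⟩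
        · omega
        · exact h1 i j (by omega) (by omega)
      · rintro (_ | t) ht
        · exact hzw
        · exact h2 t (by omega)
  obtain ⟨s, w, hs, h1, -⟩ := grow n
  have hinj : Function.Injective (fun i : Fin (s + 1) => (w i).1) := by
    intro i j hij
    by_contra hne
    rcases lt_or_gt_of_ne hne with h | h
    · exact h1 i j h (by omega) hij
    · exact h1 j i h (by omega) hij.symm
  have := Fintype.card_le_of_injective _ hinj
  simp at this
  omega

lemma card_cover_mul_le {C β : Type*} [Fintype C] {φ : C → β} (hφ : Function.Injective φ)
    (D : Finset β) (m : ℕ) :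
    Nat.card {G : Fin m → C // ∀ d ∈ D, ∃ j, φ (G j) = d} * Fintype.card C ^ D.card ≤
      m ^ D.card * Fintype.card C ^ m := by
  classical
  have hf : ∀ G : {G : Fin m → C // ∀ d ∈ D, ∃ j, φ (G j) = d}, ∃ f : D → Fin m,
      ∀ d, φ (G.1 (f d)) = d := fun G => by
    choose f hf using G.2
    exact ⟨fun d => f d.1 d.2, fun d => hf d.1 d.2⟩
  choose f hf using hf
  have hfi : ∀ G, Function.Injective (f G) := fun G a b h => by
    apply Subtype.ext
    rw [← hf G a, ← hf G b, h]
  let Φ : {G : Fin m → C // ∀ d ∈ D, ∃ j, φ (G j) = d} × (D → C) →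
      (D → Fin m) × (Fin m → C) := fun p => (f p.1, Function.extend (f p.1) p.2 p.1.1)
  have hΦ : Function.Injective Φ := by
    rintro ⟨G, h⟩ ⟨G', h'⟩ he
    obtain ⟨h1, h2⟩ := Prod.mk.inj he
    simp only at h1 h2
    have hh : h = h' := by
      funext d
      rw [← (hfi G).extend_apply h G.1 d, h2, h1, (hfi G').extend_apply]
    have hG : G = G' := by
      apply Subtype.ext
      funext j
      by_cases hj : ∃ d, f G d = j
      · obtain ⟨d, rfl⟩ := hj
        apply hφ
        rw [hf G d, h1, hf G' d]
      · rw [← Function.extend_apply' h G.1 j hj, h2, Function.extend_apply']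
        rwa [← h1]
    rw [hG, hh]
  have := Nat.card_le_card_of_injective Φ hΦ
  simpa [Nat.card_prod, Nat.card_fun] using this

lemma card_clause (n : ℕ) : Fintype.card (Clause n) = 2 * (n * (n - 1)) := by
  have h1 : Fintype.card (Clause n) =
      ∑ a : Fin n × Bool, ∑ b : Fin n × Bool, if a.1 < b.1 then 1 else 0 := by
    rw [Fintype.card_subtype, Finset.card_filter, ← Finset.univ_product_univ,
      Finset.sum_product]
  rw [h1]
  have h2 : ∀ i : Fin n, (∑ j : Fin n, if i < j then 1 else 0) = n - 1 - (i : ℕ) := by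
    intro i
    rw [← Finset.card_filter, ← Fin.card_Ioi]
    congr 1
    ext; simp
  simp only [Fintype.sum_prod_type, Fintype.sum_bool, Finset.sum_add_distrib, h2]
  rw [Fin.sum_univ_eq_sum_range (fun i => n - 1 - i), Finset.sum_range_reflect (fun i => i) n,
    ← Finset.sum_range_id_mul_two]
  ring

/-- The unordered pair of literals of a clause. -/
def clausePair {n : ℕ} (C : Clause n) : Sym2 (Fin n × Bool) := s(C.1.1, C.1.2)

lemma clausePair_injective (n : ℕ) : Function.Injective (clausePair (n := n)) := by
  rintro ⟨⟨a, b⟩, h⟩ ⟨⟨c, d⟩, h'⟩ he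
  rcases Sym2.eq_iff.mp he with ⟨h1, h2⟩ | ⟨h1, h2⟩
  · simp only at h1 h2
    simp [h1, h2]
  · simp only at h1 h2 h h'
    subst h1 h2
    exact absurd h (not_lt.mpr h'.le)

lemma fst_ne_of_clausePair_eq {n : ℕ} {C : Clause n} {a b : Fin n × Bool}
    (h : clausePair C = s(a, b)) : a.1 ≠ b.1 := by
  have hC := C.2
  rcases Sym2.eq_iff.mp h with ⟨h1, h2⟩ | ⟨h1, h2⟩
  · rw [← h1, ← h2]; exact hC.ne
  · rw [← h1, ← h2]; exact hC.ne.symm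

/-- `G` contains a chain of implications `w 0 → ⋯ → w (last)` on distinct variables.  At the end
either the last literal is falsified by `α` (`o = none`) or it implies the complement of an
earlier literal; at the start either the first literal is made true by `α` (`i = none`) or it is
implied by a literal on a later variable. -/
def Witness {n m s : ℕ} (α : PAssign n) (G : Fin m → Clause n) (w : Fin (s + 1) → Fin n × Bool)
    (o : Option (Fin (s + 1))) (i : Option (Fin (s + 1) × Bool)) : Prop :=
  Function.Injective (fun t => (w t).1) ∧
  (∀ t : Fin s, ∃ j, clausePair (G j) = s(litNeg (w t.castSucc), w t.succ)) ∧
  (match o with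
    | none => α (w (Fin.last s)).1 = some (litNeg (w (Fin.last s))).2
    | some k => k ≠ Fin.last s ∧
        ∃ j, clausePair (G j) = s(litNeg (w (Fin.last s)), litNeg (w k))) ∧
  (match i with
    | none => α (w 0).1 = some (w 0).2
    | some k => k.1 ≠ 0 ∧ ∃ j, clausePair (G j) = s(w 0, ((w k.1).1, k.2)))

lemma exists_witness {n m : ℕ} (α : PAssign n) (G : Fin m → Clause n)
    (h : ¬ ∃ σ : Fin n → Bool, (∀ x b, α x = some b → σ x = b) ∧ ∀ i, clauseSat σ (G i)) :
    ∃ r < n, ∃ (w : Fin (r + 1 + 1) → Fin n × Bool) (o : Option (Fin (r + 1 + 1)))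
      (i : Option (Fin (r + 1 + 1) × Bool)), Witness α G w o i := by
  let S : Set (Sym2 (Fin n × Bool)) :=
    {c | (∃ j, clausePair (G j) = c) ∨ ∃ l : Fin n × Bool, α l.1 = some l.2 ∧ c = s(l, l)}
  have hlit : ∀ (σ : Fin n → Bool) (l : Fin n × Bool), σ l.1 = l.2 → litVal σ l = true := by
    rintro σ ⟨v, b⟩ hl
    cases b <;> simp_all [litVal]
  have hS : ¬ ∃ σ : Fin n → Bool, ∀ c ∈ S, ∃ l ∈ c, σ l.1 = l.2 := by
    rintro ⟨σ, hσ⟩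
    refine h ⟨σ, fun x b hx => ?_, fun j => ?_⟩
    · obtain ⟨l, hl, hv⟩ := hσ s((x, b), (x, b)) (Or.inr ⟨(x, b), hx, rfl⟩)
      obtain rfl : l = (x, b) := by simpa using hl
      exact hv
    · obtain ⟨l, hl, hv⟩ := hσ _ (Or.inl ⟨j, rfl⟩)
      rcases Sym2.mem_iff.mp hl with rfl | rfl
      · exact Or.inl (hlit _ _ hv)
      · exact Or.inr (hlit _ _ hv)
  have real : ∀ a b : Fin n × Bool, a.1 ≠ b.1 → s(a, b) ∈ S → ∃ j, clausePair (G j) = s(a, b) := by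
    rintro a b hab (hj | ⟨l, -, hl⟩)
    · exact hj
    · rcases Sym2.eq_iff.mp hl with ⟨rfl, rfl⟩ | ⟨rfl, rfl⟩ <;> exact absurd rfl hab
  have unit : ∀ a b : Fin n × Bool, a.1 = b.1 → s(a, b) ∈ S → a = b ∧ α b.1 = some b.2 := by
    rintro a b hab (⟨j, hj⟩ | ⟨l, hl', hl⟩)
    · exact absurd hab (fst_ne_of_clausePair_eq hj)
    · rcases Sym2.eq_iff.mp hl with ⟨rfl, rfl⟩ | ⟨rfl, rfl⟩ <;> exact ⟨rfl, hl'⟩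
  obtain ⟨s, w, hdist, hpath, ⟨k, hk, hout⟩, z, hz, k', hk', hzk⟩ := exists_bicycle S hS
  have hinj : Function.Injective (fun i : Fin (s + 1) => (w i).1) := by
    intro i j hij
    by_contra hne
    rcases lt_or_gt_of_ne hne with h | h
    · exact hdist i j h (by omega) hij
    · exact hdist j i h (by omega) hij.symm
  have hsn : s < n := by simpa using Fintype.card_le_of_injective _ hinj
  have ho : ∃ o : Option (Fin (s + 1)), match o with
      | none => α (w s).1 = some (litNeg (w s)).2
      | some k => k ≠ Fin.last s ∧ ∃ j, clausePair (G j) = s(litNeg (w s), litNeg (w k)) := by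
    rcases hk.eq_or_lt with rfl | hlt
    · exact ⟨none, (unit _ _ rfl hout).2⟩
    · refine ⟨some ⟨k, by omega⟩, ?_, real _ _ ?_ hout⟩
      · intro he
        have := congrArg Fin.val he
        simp at this
        omega
      · exact (hdist k s hlt le_rfl).symm
  have hi : ∃ i : Option (Fin (s + 1) × Bool), match i with
      | none => α (w 0).1 = some (w 0).2
      | some k => k.1 ≠ 0 ∧ ∃ j, clausePair (G j) = s(w 0, ((w k.1).1, k.2)) := by
    rcases Nat.eq_zero_or_pos k' with rfl | hpos
    · exact ⟨none, (unit _ _ (by simpa using hzk) hz).2⟩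
    · refine ⟨some (⟨k', by omega⟩, !z.2), ?_, ?_⟩
      · intro he
        have := congrArg Fin.val he
        simp at this
        omega
      · obtain ⟨j, hj⟩ := real _ _ (by simpa [hzk] using (hdist 0 k' hpos hk').symm) hz
        refine ⟨j, ?_⟩
        rw [hj, Sym2.eq_swap, ← hzk]
        rfl
  obtain ⟨o, ho⟩ := ho
  obtain ⟨i, hi⟩ := hi
  rcases s with _ | r
  · exfalso
    have h1 : α (w 0).1 = some (w 0).2 := by
      rcases i with _ | ⟨k, b⟩
      · exact hi
      · exact absurd (Subsingleton.elim (α := Fin 1) _ _) hi.1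
    have h2 : α (w 0).1 = some (litNeg (w 0)).2 := by
      rcases o with _ | k
      · exact ho
      · exact absurd (Subsingleton.elim (α := Fin 1) _ _) ho.1
    rw [h1] at h2
    simp [litNeg] at h2
  · refine ⟨r, by omega, fun t => w t, o, i, hinj, fun t => ?_, ?_, ?_⟩
    · refine real _ _ ?_ (hpath t t.2)
      exact hdist t (t + 1) (by omega) (by omega)
    · simpa using ho
    · simpa using hi

lemma card_cover_le {C β : Type*} [Fintype C] [Nonempty C] {φ : C → β}
    (hφ : Function.Injective φ) (D : Finset β) {m : ℕ} {P : (Fin m → C) → Prop}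
    (hP : ∀ G, P G → ∀ d ∈ D, ∃ j, φ (G j) = d) :
    (Nat.card {G : Fin m → C // P G} : ℝ) ≤
      (Fintype.card C : ℝ) ^ m * ((m : ℝ) / Fintype.card C) ^ D.card := by
  have hN : (0 : ℝ) < Fintype.card C := by exact_mod_cast Fintype.card_pos
  have h1 : Nat.card {G : Fin m → C // P G} ≤
      Nat.card {G : Fin m → C // ∀ d ∈ D, ∃ j, φ (G j) = d} :=
    Nat.card_le_card_of_injective (Subtype.map id hP)
      (Subtype.map_injective hP Function.injective_id)
  have h2 : (Nat.card {G : Fin m → C // ∀ d ∈ D, ∃ j, φ (G j) = d} : ℝ) *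
      (Fintype.card C : ℝ) ^ D.card ≤ (m : ℝ) ^ D.card * (Fintype.card C : ℝ) ^ m := by
    exact_mod_cast card_cover_mul_le hφ D m
  refine (Nat.cast_le.mpr h1).trans ?_
  rw [div_pow, mul_div_assoc', le_div_iff₀ (by positivity)]
  linarith

/-- Indicator of the literals made true by `α`. -/
noncomputable def trueInd {n : ℕ} (α : PAssign n) (l : Fin n × Bool) : ℝ :=
  if α l.1 = some l.2 then 1 else 0

lemma card_witness_le {n m s : ℕ} [Nonempty (Clause n)] (α : PAssign n)
    (w : Fin (s + 1) → Fin n × Bool)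
    (o : Option (Fin (s + 1))) (i : Option (Fin (s + 1) × Bool)) :
    (Nat.card {G : Fin m → Clause n // Witness α G w o i} : ℝ) ≤
      (Fintype.card (Clause n) : ℝ) ^ m * (((m : ℝ) / Fintype.card (Clause n)) ^ s *
        (o.elim (trueInd α (litNeg (w (Fin.last s)))) fun _ => (m : ℝ) / Fintype.card (Clause n)) *
        (i.elim (trueInd α (w 0)) fun _ => (m : ℝ) / Fintype.card (Clause n))) := by
  classical
  have hind : ∀ l, 0 ≤ trueInd α l := fun l => by
    unfold trueInd
    split_ifs <;> norm_num
  by_cases hex : ∃ G : Fin m → Clause n, Witness α G w o i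
  swap
  · have : IsEmpty {G : Fin m → Clause n // Witness α G w o i} :=
      ⟨fun G => hex ⟨G.1, G.2⟩⟩
    rw [Nat.card_of_isEmpty]
    have h1 : 0 ≤ o.elim (trueInd α (litNeg (w (Fin.last s))))
        fun _ => (m : ℝ) / Fintype.card (Clause n) := by
      cases o
      · exact hind _
      · simp only [Option.elim]; positivity
    have h2 : 0 ≤ i.elim (trueInd α (w 0)) fun _ => (m : ℝ) / Fintype.card (Clause n) := by
      cases i
      · exact hind _
      · simp only [Option.elim]; positivity
    simp only [Nat.cast_zero]
    positivity
  obtain ⟨G₀, hinj, -, ho, hi⟩ := hex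
  have hneg : ∀ a b, litNeg (w a) ≠ w b := fun a b h => by
    have hab : a = b := hinj (Prod.ext_iff.mp h).1
    subst hab
    exact litNeg_ne _ h
  have hvar : ∀ {a b}, (w a).1 = (w b).1 → a = b := fun h => hinj h
  let path : Finset (Sym2 (Fin n × Bool)) :=
    univ.image fun t : Fin s => s(litNeg (w t.castSucc), w t.succ)
  have hpath : path.card = s := by
    rw [Finset.card_image_of_injective, Finset.card_univ, Fintype.card_fin]
    intro t t' h
    rcases Sym2.eq_iff.mp h with ⟨h1, -⟩ | ⟨h1, -⟩
    · exact Fin.castSucc_injective s (hvar (Prod.ext_iff.mp h1).1)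
    · exact absurd h1 (hneg _ _)
  have hcover : ∀ G : Fin m → Clause n, Witness α G w o i →
      ∀ d ∈ path, ∃ j, clausePair (G j) = d := by
    intro G hG d hd
    obtain ⟨t, -, rfl⟩ := Finset.mem_image.mp hd
    exact hG.2.1 t
  have hout : ∀ k, s(litNeg (w (Fin.last s)), litNeg (w k)) ∉ path := by
    intro k h
    obtain ⟨t, -, h⟩ := Finset.mem_image.mp h
    rcases Sym2.eq_iff.mp h with ⟨h1, -⟩ | ⟨-, h1⟩
    · exact (Fin.castSucc_lt_last t).ne (hvar (Prod.ext_iff.mp h1).1)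
    · exact hneg _ _ h1.symm
  have hin : ∀ z, s(w 0, z) ∉ path := by
    intro z h
    obtain ⟨t, -, h⟩ := Finset.mem_image.mp h
    rcases Sym2.eq_iff.mp h with ⟨h1, -⟩ | ⟨-, h1⟩
    · exact hneg _ _ h1
    · exact Fin.succ_ne_zero t (hvar (Prod.ext_iff.mp h1).1)
  rcases o with _ | k <;> rcases i with _ | ⟨k', b⟩
  · have h1 : trueInd α (litNeg (w (Fin.last s))) = 1 := if_pos ho
    have h2 : trueInd α (w 0) = 1 := if_pos hi
    simpa [h1, h2, hpath] using card_cover_le (clausePair_injective n) path hcover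
  · have h1 : trueInd α (litNeg (w (Fin.last s))) = 1 := if_pos ho
    have := card_cover_le (m := m) (P := fun G => Witness α G w none (some (k', b)))
      (clausePair_injective n) (insert s(w 0, ((w k').1, b)) path) (by
      intro G hG d hd
      rcases Finset.mem_insert.mp hd with rfl | hd
      · exact hG.2.2.2.2
      · exact hcover G hG d hd)
    rw [Finset.card_insert_of_notMem (hin _), hpath] at this
    simpa [h1, pow_succ] using this
  · have h2 : trueInd α (w 0) = 1 := if_pos hi
    have := card_cover_le (m := m) (P := fun G => Witness α G w (some k) none)
      (clausePair_injective n) (insert s(litNeg (w (Fin.last s)), litNeg (w k)) path) (by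
      intro G hG d hd
      rcases Finset.mem_insert.mp hd with rfl | hd
      · exact hG.2.2.1.2
      · exact hcover G hG d hd)
    rw [Finset.card_insert_of_notMem (hout _), hpath] at this
    simpa [h2, pow_succ] using this
  · have hne : s(litNeg (w (Fin.last s)), litNeg (w k)) ∉
        insert s(w 0, ((w k').1, b)) path := by
      rw [Finset.mem_insert, not_or]
      refine ⟨fun h => ?_, hout k⟩
      rcases Sym2.eq_iff.mp h with ⟨h1, -⟩ | ⟨-, h1⟩ <;> exact hneg _ _ h1
    have := card_cover_le (m := m) (P := fun G => Witness α G w (some k) (some (k', b)))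
      (clausePair_injective n) (insert s(litNeg (w (Fin.last s)), litNeg (w k))
        (insert s(w 0, ((w k').1, b)) path)) (by
      intro G hG d hd
      rcases Finset.mem_insert.mp hd with rfl | hd
      · exact hG.2.2.1.2
      rcases Finset.mem_insert.mp hd with rfl | hd
      · exact hG.2.2.2.2
      · exact hcover G hG d hd)
    rw [Finset.card_insert_of_notMem hne, Finset.card_insert_of_notMem (hin _), hpath] at this
    simpa [pow_succ] using this

lemma card_exists_le_sum {Ω ι : Type*} [Finite Ω] [Fintype ι] (P : ι → Ω → Prop) :
    (Nat.card {x : Ω // ∃ a, P a x} : ℝ) ≤ ∑ a, (Nat.card {x : Ω // P a x} : ℝ) := by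
  classical
  have : Fintype Ω := Fintype.ofFinite Ω
  have h : (univ.filter fun x : Ω => ∃ a, P a x) ⊆
      univ.biUnion fun a => univ.filter fun x : Ω => P a x := by
    intro x
    simp
  have := (Finset.card_le_card h).trans Finset.card_biUnion_le
  simp only [Nat.card_eq_fintype_card, Fintype.card_subtype]
  exact_mod_cast this

lemma sum_trueInd {n : ℕ} (α : PAssign n) : ∑ l, trueInd α l = (support α).card := by
  have h : ∀ v, trueInd α (v, true) + trueInd α (v, false) =
      if (α v).isSome then 1 else 0 := by
    intro v
    unfold trueInd
    rcases α v with _ | _ | _ <;> simp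
  simp [Fintype.sum_prod_type, h, support]

lemma sum_trueInd_litNeg {n : ℕ} (α : PAssign n) :
    ∑ l, trueInd α (litNeg l) = (support α).card := by
  rw [← sum_trueInd]
  exact Equiv.sum_comp (Function.Involutive.toPerm litNeg litNeg_litNeg) (trueInd α)

lemma sum_pi_last_mul_zero {L : Type*} [Fintype L] (F H : L → ℝ) (r : ℕ) :
    ∑ w : Fin (r + 1 + 1) → L, F (w (Fin.last (r + 1))) * H (w 0) =
      (∑ l, F l) * (∑ l, H l) * (Fintype.card L : ℝ) ^ r := by
  classical
  let g : Fin (r + 1 + 1) → L → ℝ := Fin.cons H (Fin.snoc (fun _ _ => 1) F)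
  have hlast : g (Fin.last (r + 1)) = F := by
    rw [← Fin.succ_last]
    simp only [g, Fin.cons_succ, Fin.snoc_last]
  have h1 := Finset.prod_univ_sum (fun _ : Fin (r + 1 + 1) => (univ : Finset L)) g
  rw [Fintype.piFinset_univ, Fin.prod_univ_succ, Fin.prod_univ_castSucc] at h1
  simp only [g, Fin.prod_univ_succ (n := r + 1), Fin.prod_univ_castSucc, Fin.cons_zero,
    Fin.cons_succ, Fin.snoc_castSucc, Fin.snoc_last, Finset.prod_const_one, one_mul,
    Finset.sum_const, Finset.prod_const, Finset.card_univ, Fintype.card_fin, nsmul_eq_mul,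
    mul_one] at h1
  calc _ = ∑ w : Fin (r + 1 + 1) → L, H (w 0) * F (w (Fin.last (r + 1))) :=
        Finset.sum_congr rfl fun w _ => mul_comm _ _
    _ = _ := h1.symm
    _ = _ := by ring

/-- Expected number of witnesses with a chain of `r + 2` literals. -/
lemma sum_card_witness_le {n m k : ℕ} [Nonempty (Clause n)] (α : PAssign n)
    (hα : (support α).card = 2 * k) (hk : 1 ≤ k) (hn : 0 < n) {δ : ℝ} (h1 : δ ≤ 1)
    (hq : 2 * n * ((m : ℝ) / Fintype.card (Clause n)) ≤ δ) (r : ℕ) :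
    ∑ w : Fin (r + 1 + 1) → Fin n × Bool, ∑ o : Option (Fin (r + 1 + 1)),
      ∑ i : Option (Fin (r + 1 + 1) × Bool),
        (Nat.card {G : Fin m → Clause n // Witness α G w o i} : ℝ) ≤
      (Fintype.card (Clause n) : ℝ) ^ m *
        (2 * k ^ 2 / n * (((r : ℝ) + 3) ^ 2 * δ ^ (r + 1))) := by
  set N : ℝ := ((Fintype.card (Clause n) : ℕ) : ℝ)
  set q : ℝ := m / N
  have hn' : (0 : ℝ) < n := by exact_mod_cast hn
  have hk' : (1 : ℝ) ≤ k := by exact_mod_cast hk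
  have hq0 : 0 ≤ q := by positivity
  calc _ ≤ ∑ w : Fin (r + 1 + 1) → Fin n × Bool, ∑ o : Option (Fin (r + 1 + 1)),
      ∑ i : Option (Fin (r + 1 + 1) × Bool), N ^ m * (q ^ (r + 1) *
        (o.elim (trueInd α (litNeg (w (Fin.last (r + 1))))) fun _ => q) *
        (i.elim (trueInd α (w 0)) fun _ => q)) := by
        gcongr with w _ o _ i _
        exact card_witness_le α w o i
    _ = N ^ m * q ^ (r + 1) * ∑ w : Fin (r + 1 + 1) → Fin n × Bool,
        (trueInd α (litNeg (w (Fin.last (r + 1)))) + (r + 2) * q) *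
          (trueInd α (w 0) + 2 * (r + 2) * q) := by
        rw [Finset.mul_sum]
        refine Finset.sum_congr rfl fun w _ => ?_
        simp only [← Finset.mul_sum, ← Finset.sum_mul, Fintype.sum_option, Option.elim,
          Finset.sum_const, Finset.card_univ, Fintype.card_fin, Fintype.card_prod,
          Fintype.card_bool, nsmul_eq_mul]
        push_cast
        ring
    _ = N ^ m * (q * (2 * n * q) ^ r * ((2 * k + (r + 2) * (2 * n * q)) *
          (2 * k + 2 * (r + 2) * (2 * n * q)))) := by
        rw [sum_pi_last_mul_zero (fun l => trueInd α (litNeg l) + (r + 2) * q)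
          (fun l => trueInd α l + 2 * (r + 2) * q)]
        simp only [Finset.sum_add_distrib, sum_trueInd, sum_trueInd_litNeg, hα,
          Finset.sum_const, Finset.card_univ, Fintype.card_fin, Fintype.card_prod,
          Fintype.card_bool, nsmul_eq_mul]
        push_cast
        ring
    _ ≤ N ^ m * (δ / (2 * n) * δ ^ r * ((2 * k * (r + 3)) * (2 * k * (r + 3)))) := by
        have hx0 : 0 ≤ 2 * n * q := by positivity
        have hδ : 0 ≤ δ := hx0.trans hq
        have hr : (0 : ℝ) ≤ r := Nat.cast_nonneg r
        have hq1 : q ≤ δ / (2 * n) := by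
          rw [le_div_iff₀ (by positivity)]
          linarith
        have hx1 : 2 * n * q ≤ 1 := hq.trans h1
        have e2 : 2 * k + 2 * (r + 2) * (2 * n * q) ≤ 2 * k * ((r : ℝ) + 3) := by
          have : 2 * ((r : ℝ) + 2) * (2 * n * q) ≤ 2 * (r + 2) * k := by
            gcongr
            linarith
          linarith
        have e1 : 2 * k + (r + 2) * (2 * n * q) ≤ 2 * k * ((r : ℝ) + 3) := by
          have : 0 ≤ ((r : ℝ) + 2) * (2 * n * q) := by positivity
          linarith
        gcongr
    _ = _ := by
        field_simp
        ring

lemma card_not_extendable_le {n m k : ℕ} [Nonempty (Clause n)] (α : PAssign n)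
    (hα : (support α).card = 2 * k) (hk : 1 ≤ k) (hn : 0 < n) {δ : ℝ} (h1 : δ < 1)
    (hq : 2 * n * ((m : ℝ) / Fintype.card (Clause n)) ≤ δ) :
    (Nat.card {G : Fin m → Clause n // ¬ ∃ σ : Fin n → Bool,
        (∀ x b, α x = some b → σ x = b) ∧ ∀ i, clauseSat σ (G i)} : ℝ) ≤
      (Fintype.card (Clause n) : ℝ) ^ m *
        (2 * k ^ 2 / n * ∑' r : ℕ, ((r : ℝ) + 3) ^ 2 * δ ^ (r + 1)) := by
  have hδ : 0 ≤ δ := le_trans (by positivity) hq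
  have hsum : Summable fun r : ℕ => ((r : ℝ) + 3) ^ 2 * δ ^ (r + 1) := by
    have hn1 : ‖δ‖ < 1 := by rwa [Real.norm_of_nonneg hδ]
    have a2 := (summable_pow_mul_geometric_of_norm_lt_one 2 hn1).mul_right δ
    have a1 := (summable_pow_mul_geometric_of_norm_lt_one 1 hn1).mul_right (6 * δ)
    have a0 := (summable_pow_mul_geometric_of_norm_lt_one 0 hn1).mul_right (9 * δ)
    refine ((a2.add a1).add a0).congr fun r => ?_
    ring
  have hsub : ∀ G : Fin m → Clause n, (¬ ∃ σ : Fin n → Bool,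
      (∀ x b, α x = some b → σ x = b) ∧ ∀ i, clauseSat σ (G i)) →
      ∃ (r : Fin n) (w : Fin (r + 1 + 1) → Fin n × Bool) (o : Option (Fin (r + 1 + 1)))
        (i : Option (Fin (r + 1 + 1) × Bool)), Witness α G w o i := by
    intro G hG
    obtain ⟨r, hr, h⟩ := exists_witness α G hG
    exact ⟨⟨r, hr⟩, h⟩
  calc _ ≤ (Nat.card {G : Fin m → Clause n // ∃ (r : Fin n)
        (w : Fin (r + 1 + 1) → Fin n × Bool) (o : Option (Fin (r + 1 + 1)))
        (i : Option (Fin (r + 1 + 1) × Bool)), Witness α G w o i} : ℝ) :=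
        Nat.cast_le.mpr (Nat.card_mono (Set.toFinite _) hsub)
    _ ≤ ∑ r : Fin n, ∑ w : Fin (r + 1 + 1) → Fin n × Bool, ∑ o : Option (Fin (r + 1 + 1)),
      ∑ i : Option (Fin (r + 1 + 1) × Bool),
        (Nat.card {G : Fin m → Clause n // Witness α G w o i} : ℝ) := by
        refine (card_exists_le_sum _).trans (Finset.sum_le_sum fun r _ => ?_)
        refine (card_exists_le_sum _).trans (Finset.sum_le_sum fun w _ => ?_)
        refine (card_exists_le_sum _).trans (Finset.sum_le_sum fun o _ => ?_)
        exact card_exists_le_sum _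
    _ ≤ ∑ r : Fin n, (Fintype.card (Clause n) : ℝ) ^ m *
        (2 * k ^ 2 / n * ((((r : ℕ) : ℝ) + 3) ^ 2 * δ ^ ((r : ℕ) + 1))) :=
        Finset.sum_le_sum fun r _ => sum_card_witness_le α hα hk hn h1.le hq r
    _ ≤ _ := by
        rw [← Finset.mul_sum, ← Finset.mul_sum]
        gcongr
        rw [Fin.sum_univ_eq_sum_range (fun r : ℕ => ((r : ℝ) + 3) ^ 2 * δ ^ (r + 1))]
        exact hsum.sum_le_tsum _ fun r _ => by positivity

lemma pr_le_one {Ω : Type*} [Fintype Ω] (P : Ω → Prop) : pr Ω P ≤ 1 := by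
  unfold pr
  refine div_le_one_of_le₀ ?_ (Nat.cast_nonneg _)
  rw [← Nat.card_eq_fintype_card]
  exact_mod_cast Nat.card_le_card_of_injective _ Subtype.val_injective

/-- A conditional lower bound on the probability of an event in a product space that holds for
every value of the second coordinate also holds unconditionally. -/
lemma one_sub_le_pr_prod {Ω Θ : Type*} [Fintype Ω] [Fintype Θ] [Nonempty Ω] [Nonempty Θ]
    (P : Ω × Θ → Prop) {ε : ℝ}
    (h : ∀ θ, (Nat.card {ω : Ω // ¬ P (ω, θ)} : ℝ) ≤ Fintype.card Ω * ε) :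
    1 - ε ≤ pr (Ω × Θ) P := by
  classical
  have hΩ : (0 : ℝ) < Fintype.card Ω := by exact_mod_cast Fintype.card_pos
  have hΘ : (0 : ℝ) < Fintype.card Θ := by exact_mod_cast Fintype.card_pos
  have hbad : (Nat.card {p : Ω × Θ // ¬ P p} : ℝ) ≤ Fintype.card Θ * (Fintype.card Ω * ε) := by
    have e : Nat.card {p : Ω × Θ // ¬ P p} = ∑ θ, Nat.card {ω : Ω // ¬ P (ω, θ)} := by
      simp only [Nat.card_eq_fintype_card, Fintype.card_subtype, Finset.card_filter]
      rw [Fintype.sum_prod_type_right]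
    rw [e, Nat.cast_sum]
    refine (Finset.sum_le_sum fun θ _ => h θ).trans ?_
    simp
  have hcompl : (Nat.card {p : Ω × Θ // P p} : ℝ) + Nat.card {p : Ω × Θ // ¬ P p} =
      Fintype.card Ω * Fintype.card Θ := by
    rw [← Nat.cast_add, ← Nat.cast_mul, ← Fintype.card_prod, Nat.card_eq_fintype_card,
      Nat.card_eq_fintype_card, Fintype.card_subtype_compl]
    congr 1
    have := Fintype.card_subtype_le P
    omega
  unfold pr
  rw [Fintype.card_prod, Nat.cast_mul, le_div_iff₀ (by positivity)]
  linarith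

lemma nonempty_PAk {n k : ℕ} (h : k ≤ n) : Nonempty (PAk n k) := by
  obtain ⟨s, -, hs⟩ := Finset.exists_subset_card_eq (s := (univ : Finset (Fin n))) (n := k)
    (by simpa using h)
  refine ⟨⟨fun x => if x ∈ s then some true else none, ?_⟩⟩
  rw [← hs]
  congr 1
  ext x
  by_cases hx : x ∈ s <;> simp [support, hx]

/-- For `1/2 ≤ δ < 1`, `k = ⌈n^{1/3}⌉` and `m = ⌊δn⌋ − k`: drawing
`G = C_1 ∧ ⋯ ∧ C_m ∼ 𝓗₂(n,m)` (i.i.d. uniform 2-clauses) and, independently, a uniform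
partial assignment `α` to exactly `2k` variables, the probability that `α ∧ G` is
satisfiable tends to `1`. -/
theorem random_assignment_extends_H (δ : ℝ) (h0 : 1 / 2 ≤ δ) (h1 : δ < 1) :
    Tendsto (fun n : ℕ =>
      pr ((Fin (⌊δ * n⌋₊ - ⌈(n : ℝ) ^ ((1 : ℝ) / 3)⌉₊) → Clause n)
          × PAk n (2 * ⌈(n : ℝ) ^ ((1 : ℝ) / 3)⌉₊))
        (fun p => ∃ σ : Fin n → Bool,
          (∀ x b, p.2.val x = some b → σ x = b) ∧ ∀ i, clauseSat σ (p.1 i)))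
      atTop (nhds 1) := by
  set K : ℕ → ℕ := fun n => ⌈(n : ℝ) ^ ((1 : ℝ) / 3)⌉₊ with hK
  set c : ℝ := ∑' r : ℕ, ((r : ℝ) + 3) ^ 2 * δ ^ (r + 1)
  have hc : 0 ≤ c := tsum_nonneg fun r => by positivity
  have hKlim : Tendsto (fun n : ℕ => 8 * c * (n : ℝ) ^ (-((1 : ℝ) / 3))) atTop (nhds 0) := by
    have := ((tendsto_rpow_neg_atTop (show (0 : ℝ) < 1 / 3 by norm_num)).comp
      (tendsto_natCast_atTop_atTop (R := ℝ))).const_mul (8 * c)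
    simpa using this
  have hlow : Tendsto (fun n : ℕ => 1 - 8 * c * (n : ℝ) ^ (-((1 : ℝ) / 3))) atTop (nhds 1) := by
    simpa using hKlim.const_sub 1
  refine tendsto_of_tendsto_of_tendsto_of_le_of_le' hlow tendsto_const_nhds ?_
    (Eventually.of_forall fun n => pr_le_one _)
  filter_upwards [eventually_ge_atTop 8] with n hn
  have hn' : (8 : ℝ) ≤ n := by exact_mod_cast hn
  set x : ℝ := (n : ℝ) ^ ((1 : ℝ) / 3) with hx
  have hx3 : x ^ 3 = n := by
    rw [hx, ← Real.rpow_natCast, ← Real.rpow_mul (by positivity)]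
    norm_num
  have hx0 : 0 ≤ x := by positivity
  have hx2 : 2 ≤ x := by
    by_contra! hlt
    have : x ^ 3 < 2 ^ 3 := by gcongr
    linarith
  have hxK : x ≤ K n := Nat.le_ceil _
  have hKx : (K n : ℝ) ≤ 2 * x := by
    have := Nat.ceil_lt_add_one hx0
    simp only [hK, ← hx]
    linarith
  have hK1 : 1 ≤ K n := by
    have : (1 : ℝ) ≤ K n := by linarith
    exact_mod_cast this
  have hKn : 2 * K n ≤ n := by
    have h4 : (K n : ℝ) < x + 1 := Nat.ceil_lt_add_one hx0
    have h5 : (2 * K n : ℝ) ≤ n := by nlinarith [mul_nonneg hx0 (sub_nonneg.mpr hx2)]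
    exact_mod_cast h5
  have hcard : (Fintype.card (Clause n) : ℝ) = 2 * (n * (n - 1)) := by
    rw [card_clause, Nat.cast_mul, Nat.cast_mul, Nat.cast_sub (by omega)]
    norm_num
  have hne : Nonempty (Clause n) := by
    rw [← Fintype.card_pos_iff, card_clause]
    have : 0 < n - 1 := by omega
    positivity
  have hneP : Nonempty (PAk n (2 * K n)) := nonempty_PAk hKn
  have hm : ((⌊δ * n⌋₊ - K n : ℕ) : ℝ) ≤ δ * (n - 1) := by
    rcases le_total ⌊δ * (n : ℝ)⌋₊ (K n) with h | h
    · rw [Nat.sub_eq_zero_of_le h, Nat.cast_zero]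
      nlinarith
    · rw [Nat.cast_sub h]
      have := Nat.floor_le (show 0 ≤ δ * (n : ℝ) by positivity)
      linarith
  have hq : 2 * n * (((⌊δ * n⌋₊ - K n : ℕ) : ℝ) / Fintype.card (Clause n)) ≤ δ := by
    rw [hcard, mul_div_assoc', div_le_iff₀ (by nlinarith)]
    nlinarith
  have hε : 2 * (K n : ℝ) ^ 2 / n * c ≤ 8 * c * (n : ℝ) ^ (-((1 : ℝ) / 3)) := by
    rw [Real.rpow_neg (by positivity), ← hx, ← hx3]
    calc 2 * (K n : ℝ) ^ 2 / x ^ 3 * c ≤ 2 * (2 * x) ^ 2 / x ^ 3 * c := by gcongr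
      _ = 8 * c * x⁻¹ := by
        field_simp
        ring
  refine (sub_le_sub_left hε 1).trans (one_sub_le_pr_prod _ fun α => ?_)
  rw [Fintype.card_fun, Fintype.card_fin, Nat.cast_pow]
  exact card_not_extendable_le α.1 α.2 hK1 (by omega) h1 hq
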